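/- Let P be a partial order and K ⊆ P a lower set. Let I be the three-element partial order {0⁻, 0⁺, 1} whose only strict order relations are 0⁻ < 1 and 0⁺ < 1. Let C := K ⊕ (I × {x : P // x ∉ K}) carry the partial order: inl z ≤ inl z' iff z ≤ z'; inl z ≤ inr (j, y) iff z ≤ y; inr (i, x) ≤ inl z' never; inr (i, x) ≤ inr (j, y) iff i ≤ j and x ≤ y. Define q : I × P → C by q (i, x) = inl x if x ∈ K and q (i, x) = inr (i, x) otherwise, and let ι : K → C be the map inl. Then: (1) q and ι are monotone; (2) q (i, x) = ι x for all i ∈ I and x ∈ K; (3) for every partial order Q and monotone maps v : I × P → Q and u : K → Q satisfying v (i, x) = u x for all i ∈ I and x ∈ K, there exists a unique monotone map w : C → Q such that w ∘ q = v and w ∘ ι = u. In other words, C with q and ι is the pushout, in the category of partial orders and monotone maps, of the projection I × K → K along the inclusion I × K ↪ I × P. -/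

import Mathlib

/-- The face poset `I` of the oriented 1-ball: elements `0⁻`, `0⁺`, `1`,
with only strict relations `0⁻ < 1` and `0⁺ < 1`. -/
inductive Ar : Type
  | minus : Ar
  | plus : Ar
  | top : Ar
deriving DecidableEq

instance : PartialOrder Ar where
  le a b := a = b ∨ b = Ar.top
  le_refl a := Or.inl rfl
  le_trans a b c hab hbc := by
    rcases hab with rfl | rfl
    · exact hbc
    · rcases hbc with rfl | rfl <;> exact Or.inr rfl
  le_antisymm a b hab hba := by
    rcases hab with rfl | rfl
    · rfl
    · rcases hba with rfl | rfl <;> rfl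

/-- The underlying type of the partial cylinder `I ×_K P`:
elements of `K`, plus pairs `(i, x)` with `i ∈ I` and `x ∉ K`. -/
abbrev Cyl (P : Type*) (K : Set P) : Type _ :=
  ↥K ⊕ (Ar × {x : P // x ∉ K})

/-- The order relation on the partial cylinder. -/
def cylLe {P : Type*} [PartialOrder P] (K : Set P) :
    Cyl P K → Cyl P K → Prop
  | Sum.inl z, Sum.inl z' => (z : P) ≤ (z' : P)
  | Sum.inl z, Sum.inr jy => (z : P) ≤ (jy.2 : P)
  | Sum.inr _, Sum.inl _ => False
  | Sum.inr ix, Sum.inr jy => ix.1 ≤ jy.1 ∧ (ix.2 : P) ≤ (jy.2 : P)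

/-- The quotient map `q : I × P → I ×_K P`. -/
noncomputable def cylQ {P : Type*} (K : Set P) : Ar × P → Cyl P K := fun ix =>
  letI := Classical.dec (ix.2 ∈ K)
  if h : ix.2 ∈ K then Sum.inl ⟨ix.2, h⟩ else Sum.inr (ix.1, ⟨ix.2, h⟩)

theorem cylQ_of_mem {P : Type*} {K : Set P} (i : Ar) {x : P} (hx : x ∈ K) :
    cylQ K (i, x) = Sum.inl ⟨x, hx⟩ :=
  dif_pos hx

theorem cylQ_of_notMem {P : Type*} {K : Set P} (i : Ar) {x : P} (hx : x ∉ K) :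
    cylQ K (i, x) = Sum.inr (i, ⟨x, hx⟩) :=
  dif_neg hx

theorem cylQ_mono {P : Type*} [PartialOrder P] {K : Set P} (hK : IsLowerSet K)
    (a b : Ar × P) (hab : a ≤ b) : cylLe K (cylQ K a) (cylQ K b) := by
  obtain ⟨i, x⟩ := a
  obtain ⟨j, y⟩ := b
  obtain ⟨hij, hxy⟩ := Prod.mk_le_mk.1 hab
  by_cases hy : y ∈ K
  · rw [cylQ_of_mem j hy, cylQ_of_mem i (hK hxy hy)]
    exact hxy
  · rw [cylQ_of_notMem j hy]
    by_cases hx : x ∈ K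
    · rw [cylQ_of_mem i hx]
      exact hxy
    · rw [cylQ_of_notMem i hx]
      exact ⟨hij, hxy⟩

/-- The map out of the partial cylinder induced by maps on `I × P` and on `K`. -/
def cylDesc {P Q : Type*} {K : Set P} (v : Ar × P → Q) (u : K → Q) : Cyl P K → Q :=
  Sum.elim u fun ix => v (ix.1, ix.2)

theorem cylDesc_mono {P Q : Type*} [PartialOrder P] [PartialOrder Q] {K : Set P}
    {v : Ar × P → Q} {u : K → Q} (hv : Monotone v) (hu : Monotone u)
    (huv : ∀ (i : Ar) (x : P) (hx : x ∈ K), v (i, x) = u ⟨x, hx⟩)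
    (a b : Cyl P K) (hab : cylLe K a b) : cylDesc v u a ≤ cylDesc v u b := by
  match a, b, hab with
  | Sum.inl _, Sum.inl _, h => exact hu h
  | Sum.inl z, Sum.inr (j, y), h =>
    exact (huv j z z.2).symm.le.trans (hv (Prod.mk_le_mk.2 ⟨le_rfl, h⟩))
  | Sum.inr _, Sum.inr _, h => exact hv (Prod.mk_le_mk.2 h)

/-- The partial cylinder `I ×_K P`, with the maps `q : I × P → I ×_K P` and
`ι = Sum.inl : K → I ×_K P`, is the pushout in the category of posets and monotone
maps of the projection `I × K → K` along the inclusion `I × K ↪ I × P`: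
(1) `q` and `ι` are monotone; (2) `q (i, x) = ι x` for `x ∈ K`; (3) the universal
property: for every poset `Q` and monotone `v : I × P → Q`, `u : K → Q` with
`v (i, x) = u x` whenever `x ∈ K`, there is a unique monotone `w : I ×_K P → Q`
with `w ∘ q = v` and `w ∘ ι = u`. -/
theorem cyl_is_pushout {P : Type*} [PartialOrder P] (K : Set P)
    (hK : IsLowerSet K) :
    (∀ a b : Ar × P, a ≤ b → cylLe K (cylQ K a) (cylQ K b)) ∧
    (∀ z z' : K, (z : P) ≤ (z' : P) →
      cylLe K (Sum.inl z : Cyl P K) (Sum.inl z')) ∧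
    (∀ (i : Ar) (x : P) (hx : x ∈ K),
      cylQ K (i, x) = (Sum.inl ⟨x, hx⟩ : Cyl P K)) ∧
    (∀ (Q : Type*) [PartialOrder Q] (v : Ar × P → Q) (u : K → Q),
      Monotone v → Monotone u →
      (∀ (i : Ar) (x : P) (hx : x ∈ K), v (i, x) = u ⟨x, hx⟩) →
      ∃! w : Cyl P K → Q,
        (∀ a b : Cyl P K, cylLe K a b → w a ≤ w b) ∧
        (∀ a : Ar × P, w (cylQ K a) = v a) ∧
        (∀ z : K, w (Sum.inl z) = u z)) := by
  refine ⟨cylQ_mono hK, fun _ _ h => h, fun i x hx => cylQ_of_mem i hx, ?_⟩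
  intro Q _ v u hv hu huv
  refine ⟨cylDesc v u, ⟨cylDesc_mono hv hu huv, ?_, fun _ => rfl⟩, ?_⟩
  · rintro ⟨i, x⟩
    by_cases hx : x ∈ K
    · rw [cylQ_of_mem i hx, huv i x hx]
      rfl
    · rw [cylQ_of_notMem i hx]
      rfl
  · rintro w ⟨-, hq, hι⟩
    ext (z | ⟨i, x, hx⟩)
    · exact hι z
    · exact (congrArg w (cylQ_of_notMem i hx)).symm.trans (hq (i, x))
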